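/- (Correctness of the big-M encoding of temporal counting propositions.) Let N ∈ ℕ, let z : Fin N → ℤ satisfy 0 ≤ z(n) ≤ 1 for all n, let y ∈ ℤ satisfy 0 ≤ y ≤ 1, and let m, M ∈ ℤ satisfy 0 ≤ m ≤ M and M ≥ N + 1. Then the pair of inequalities m − M ≤ (Σ_{n} z(n)) − M·y and (Σ_{n} z(n)) − M·y < m holds if and only if (y = 1 ↔ Σ_{n} z(n) ≥ m). -/

import Mathlib

/-- Correctness of the big-M encoding of temporal counting propositions. -/
theorem bigM_tcp_encoding_correct (N : ℕ) (z : Fin N → ℤ)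
    (hz : ∀ n, 0 ≤ z n ∧ z n ≤ 1) (y m M : ℤ)
    (hy : 0 ≤ y ∧ y ≤ 1) (hm0 : 0 ≤ m) (hmM : m ≤ M) (hMN : (N : ℤ) + 1 ≤ M) :
    (m - M ≤ (∑ n, z n) - M * y ∧ (∑ n, z n) - M * y < m) ↔
      (y = 1 ↔ m ≤ ∑ n, z n) := by
  have hS0 : 0 ≤ ∑ n, z n := Finset.sum_nonneg fun n _ => (hz n).1
  have hSN : ∑ n, z n ≤ N := by
    simpa using Finset.sum_le_card_nsmul Finset.univ z 1 fun n _ => (hz n).2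
  obtain rfl | rfl : y = 0 ∨ y = 1 := by omega
  all_goals omega
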